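/- Strong duality for convex programs under a boundedness condition: under assumption (F), if the feasible region of the primal problem (P) is nonempty and bounded, then the infimum of (P) coincides with the supremum of the dual problem (D) and (P) is solvable; likewise, if the feasible region of (D) is nonempty and bounded, then the infimum of (P) coincides with the supremum of (D) and (D) is solvable. -/

import Mathlib

noncomputable section
open scoped BigOperators Classical

/-- Dot product on `ℝ^n`. -/
def dotp {n : ℕ} (x y : Fin n → ℝ) : ℝ := ∑ i, x i * y i

/-- The (effective) domain of an extended-real-valued function. -/
def edom {n : ℕ} (f : (Fin n → ℝ) → EReal) : Set (Fin n → ℝ) := {x | f x < ⊤}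

/-- `f` is proper: it never takes the value `−∞` and is `< +∞` somewhere. -/
def ProperFn {n : ℕ} (f : (Fin n → ℝ) → EReal) : Prop := (∀ x, f x ≠ ⊥) ∧ (∃ x, f x ≠ ⊤)

/-- `f` is closed: lower semicontinuous, and either nowhere `−∞` or identically `−∞`. -/
def ClosedFn {n : ℕ} (f : (Fin n → ℝ) → EReal) : Prop :=
  LowerSemicontinuous f ∧ ((∀ x, f x ≠ ⊥) ∨ (∀ x, f x = ⊥))

/-- Convexity of an extended-real-valued function, via convexity of its epigraph. -/
def ConvexFn {n : ℕ} (f : (Fin n → ℝ) → EReal) : Prop :=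
  Convex ℝ {p : (Fin n → ℝ) × ℝ | f p.1 ≤ (p.2 : EReal)}

/-- The conjugate `f*(w) = sup_x { wᵀx − f(x) }`. -/
def conjFn {n : ℕ} (f : (Fin n → ℝ) → EReal) (w : Fin n → ℝ) : EReal :=
  ⨆ x : Fin n → ℝ, (((dotp w x : ℝ) : EReal) - f x)

/-- The support function `δ*_X(w) = sup_{x ∈ X} xᵀw`. -/
def suppFn {n : ℕ} (X : Set (Fin n → ℝ)) (w : Fin n → ℝ) : EReal :=
  ⨆ x ∈ X, ((dotp x w : ℝ) : EReal)

/-- The convex perspective `t f(x/t)` of a proper closed convex function `f`,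
equal to `t f(x/t)` for `t > 0` and to `δ*_{dom f*}(x)` for `t = 0`. -/
def persp {n : ℕ} (f : (Fin n → ℝ) → EReal) (x : Fin n → ℝ) (t : ℝ) : EReal :=
  if 0 < t then (t : EReal) * f (t⁻¹ • x) else suppFn (edom (conjFn f)) x

variable {n I : ℕ}

/-- Assumption (F): each `f_i`, `i = 0, 1, …, I`, is proper, closed and convex. -/
def AssumptionF (f : Fin (I + 1) → (Fin n → ℝ) → EReal) : Prop :=
  ∀ i, ProperFn (f i) ∧ ClosedFn (f i) ∧ ConvexFn (f i)

/-- Feasible region of the primal problem (P): the constraints `f_i(x) ≤ 0` hold for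
`i = 1, …, I` and the objective value is not `+∞`. -/
def primalFeas (f : Fin (I + 1) → (Fin n → ℝ) → EReal) : Set (Fin n → ℝ) :=
  {x | (∀ i : Fin I, f i.succ x ≤ 0) ∧ f 0 x ≠ ⊤}

/-- Optimal value of the primal problem (P) (`+∞` if (P) is infeasible). -/
def primalVal (f : Fin (I + 1) → (Fin n → ℝ) → EReal) : EReal :=
  ⨅ x ∈ primalFeas f, f 0 x

/-- (P) is solvable: it is infeasible, or a feasible point attains the optimal value. -/
def primalSolvable (f : Fin (I + 1) → (Fin n → ℝ) → EReal) : Prop :=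
  primalFeas f = ∅ ∨ ∃ x ∈ primalFeas f, f 0 x = primalVal f

/-- Objective of the dual problem (D):
`−f₀*(w₀) − Σ_{i=1}^I λ_i f_i*(w_i/λ_i)` (perspectives of the conjugates). -/
def dualObj (f : Fin (I + 1) → (Fin n → ℝ) → EReal)
    (w : Fin (I + 1) → Fin n → ℝ) (lam : Fin I → ℝ) : EReal :=
  - conjFn (f 0) (w 0) - ∑ i : Fin I, persp (conjFn (f i.succ)) (w i.succ) (lam i)

/-- Feasible region of the dual problem (D): `Σ_i w_i = 0`, `λ ≥ 0`, and the
objective value is not `−∞`. -/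
def dualFeas (f : Fin (I + 1) → (Fin n → ℝ) → EReal) :
    Set ((Fin (I + 1) → Fin n → ℝ) × (Fin I → ℝ)) :=
  {p | (∑ i, p.1 i) = 0 ∧ (∀ i, 0 ≤ p.2 i) ∧ dualObj f p.1 p.2 ≠ ⊥}

/-- Optimal value of the dual problem (D) (`−∞` if (D) is infeasible). -/
def dualVal (f : Fin (I + 1) → (Fin n → ℝ) → EReal) : EReal :=
  ⨆ p ∈ dualFeas f, dualObj f p.1 p.2

/-- (D) is solvable: it is infeasible, or a feasible point attains the optimal value. -/
def dualSolvable (f : Fin (I + 1) → (Fin n → ℝ) → EReal) : Prop :=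
  dualFeas f = ∅ ∨ ∃ p ∈ dualFeas f, dualObj f p.1 p.2 = dualVal f

/-- `f` is an affine ("linear") constraint function. -/
def IsAffineFn {n : ℕ} (f : (Fin n → ℝ) → EReal) : Prop :=
  ∃ (a : Fin n → ℝ) (b : ℝ), ∀ x, f x = ((dotp a x + b : ℝ) : EReal)

/-- Slater point of the primal problem (P): `xS` lies in the relative interior of the
domains of `f₀, …, f_I`, is feasible, and satisfies every nonlinear inequality
constraint strictly. -/
def SlaterPrimal (f : Fin (I + 1) → (Fin n → ℝ) → EReal) (xS : Fin n → ℝ) : Prop :=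
  (∀ i : Fin (I + 1), xS ∈ intrinsicInterior ℝ (edom (f i))) ∧
  (∀ i : Fin I, f i.succ xS ≤ 0) ∧
  (∀ i : Fin I, ¬ IsAffineFn (f i.succ) → f i.succ xS < 0)

/-- Slater point of the dual problem (D) (a maximization problem whose explicit
constraints are the affine equalities `Σ_i w_i = 0` and the linear inequalities
`λ ≥ 0`): a feasible point in the relative interior of the domain of minus the
objective. -/
def SlaterDual (f : Fin (I + 1) → (Fin n → ℝ) → EReal)
    (p : (Fin (I + 1) → Fin n → ℝ) × (Fin I → ℝ)) : Prop :=
  p ∈ intrinsicInterior ℝ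
      {q : (Fin (I + 1) → Fin n → ℝ) × (Fin I → ℝ) | dualObj f q.1 q.2 ≠ ⊥} ∧
  (∑ i, p.1 i) = 0 ∧ (∀ i, 0 ≤ p.2 i)

/-- Strict Slater point of the dual problem (D): additionally all inequality
constraints `λ ≥ 0` hold strictly. -/
def StrictSlaterDual (f : Fin (I + 1) → (Fin n → ℝ) → EReal)
    (p : (Fin (I + 1) → Fin n → ℝ) × (Fin I → ℝ)) : Prop :=
  SlaterDual f p ∧ ∀ i, 0 < p.2 i

section ConvexGeometry

variable {E F : Type*} [NormedAddCommGroup E] [NormedSpace ℝ E] [FiniteDimensional ℝ E]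
  [NormedAddCommGroup F] [NormedSpace ℝ F]

/-- A point of the closure of the linear image of a closed convex set `K` lies in that image as
soon as the part of `K` lying over a segment from the point to a point of the image is bounded. -/
theorem mem_image_of_mem_closure_image_of_isBounded {K : Set E} (hK : IsClosed K)
    (hKc : Convex ℝ K) (B : E →L[ℝ] F) {e : E} (he : e ∈ K) {p : F}
    (hb : Bornology.IsBounded (K ∩ B ⁻¹' segment ℝ (B e) p)) (hp : p ∈ closure (B '' K)) :
    p ∈ B '' K := by
  obtain ⟨R, hR⟩ := hb.subset_ball e
  have heR : e ∈ Metric.ball e R := hR ⟨he, left_mem_segment ℝ _ _⟩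
  have hR0 : 0 < R := by simpa using heR
  set C : Set (ℝ × E) := Set.Icc (0 : ℝ) 1 ×ˢ (K ∩ Metric.sphere e R)
  have hC : IsCompact C := isCompact_Icc.prod ((isCompact_sphere e R).inter_left hK)
  set g : ℝ × E → F := fun q => B q.2 - ((1 - q.1) • B e + q.1 • p)
  have hg : Continuous g := by fun_prop
  have h0 : (0 : F) ∉ g '' C := by
    rintro ⟨⟨t, z⟩, ⟨ht, hzK, hzs⟩, hz⟩
    have hz' : B z ∈ segment ℝ (B e) p :=
      ⟨1 - t, t, by linarith [ht.2], ht.1, by ring, (sub_eq_zero.1 hz).symm⟩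
    have h1 := hR ⟨hzK, hz'⟩
    rw [Metric.mem_ball] at h1
    rw [Metric.mem_sphere] at hzs
    exact h1.ne hzs
  obtain ⟨δ, hδ, hδC⟩ := Metric.isOpen_iff.1 (hC.image hg).isClosed.isOpen_compl 0 h0
  have hcl : IsClosed (B '' (K ∩ Metric.closedBall e R)) :=
    (((isCompact_closedBall e R).inter_left hK).image B.continuous).isClosed
  suffices p ∈ closure (B '' (K ∩ Metric.closedBall e R)) by
    rw [hcl.closure_eq] at this
    exact Set.image_mono Set.inter_subset_left this
  rw [Metric.mem_closure_iff] at hp ⊢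
  intro ε hε
  obtain ⟨_, ⟨k, hk, rfl⟩, hkp⟩ := hp (min ε δ) (lt_min hε hδ)
  refine ⟨B k, ⟨k, ⟨hk, ?_⟩, rfl⟩, hkp.trans_le (min_le_left _ _)⟩
  by_contra hfar
  rw [Metric.mem_closedBall, not_le, dist_eq_norm] at hfar
  have hpos : 0 < ‖k - e‖ := hR0.trans hfar
  set t := R / ‖k - e‖
  have ht0 : 0 ≤ t := by positivity
  have ht1 : t ≤ 1 := (div_le_one hpos).2 hfar.le
  have hzK : e + t • (k - e) ∈ K := hKc.add_smul_sub_mem he hk ⟨ht0, ht1⟩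
  have hzs : e + t • (k - e) ∈ Metric.sphere e R := by
    rw [mem_sphere_iff_norm, add_sub_cancel_left, norm_smul, Real.norm_of_nonneg ht0]
    exact div_mul_cancel₀ _ hpos.ne'
  refine hδC (?_ : g (t, e + t • (k - e)) ∈ _) ⟨(t, _), ⟨⟨ht0, ht1⟩, hzK, hzs⟩, rfl⟩
  have hgt : g (t, e + t • (k - e)) = t • (B k - p) := by
    simp only [g, map_add, map_smul, map_sub]
    module
  rw [mem_ball_zero_iff, hgt, norm_smul, Real.norm_of_nonneg ht0]
  have h2 : ‖B k - p‖ < δ := by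
    rw [← dist_eq_norm, dist_comm]
    exact hkp.trans_le (min_le_right _ _)
  nlinarith [norm_nonneg (B k - p)]

/-- A closed set `K ⊆ E × ℝ` that is closed upwards and contains no vertical line has a lowest
point over `ker A`, provided its projection meets `ker A` in a nonempty bounded set. -/
theorem exists_lowest_point {K : Set (E × ℝ)} (hK : IsClosed K)
    (hup : ∀ y r r', (y, r) ∈ K → r ≤ r' → (y, r') ∈ K) (hline : ∀ y, ∃ r, (y, r) ∉ K)
    (A : E →L[ℝ] F) (hne : ∃ y r, (y, r) ∈ K ∧ A y = 0)
    (hb : Bornology.IsBounded {y | A y = 0 ∧ ∃ r, (y, r) ∈ K}) :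
    ∃ y m, (y, m) ∈ K ∧ A y = 0 ∧ ∀ y' r, (y', r) ∈ K → A y' = 0 → m ≤ r := by
  obtain ⟨y₀, r₀, h₀, hA₀⟩ := hne
  set S : ℝ → Set E := fun r => {y | A y = 0 ∧ (y, r) ∈ K}
  have hSc : ∀ r, IsClosed (S r) := fun r =>
    (isClosed_singleton.preimage A.continuous).inter
      (hK.preimage (by fun_prop : Continuous fun y : E => (y, r)))
  have hSk : ∀ r, IsCompact (S r) := fun r =>
    Metric.isCompact_of_isClosed_isBounded (hSc r) (hb.subset fun y hy => ⟨hy.1, r, hy.2⟩)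
  have hlow : ∃ r, S r = ∅ := by
    by_contra! hS
    obtain ⟨y, hy⟩ := IsCompact.nonempty_iInter_of_directed_nonempty_isCompact_isClosed S
      (fun a b => ⟨min a b, fun y hy => ⟨hy.1, hup _ _ _ hy.2 (min_le_left _ _)⟩,
        fun y hy => ⟨hy.1, hup _ _ _ hy.2 (min_le_right _ _)⟩⟩) hS hSk hSc
    obtain ⟨r, hr⟩ := hline y
    exact hr (Set.mem_iInter.1 hy r).2
  obtain ⟨ρ, hρ⟩ := hlow
  have hρ' : ∀ y r, (y, r) ∈ K → A y = 0 → ρ ≤ r := by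
    intro y r hy hA
    by_contra! hlt
    exact (Set.eq_empty_iff_forall_notMem.1 hρ y) ⟨hA, hup _ _ _ hy hlt.le⟩
  have hcomp : IsCompact (K ∩ (S r₀ ×ˢ Set.Icc ρ r₀)) := ((hSk r₀).prod isCompact_Icc).inter_left hK
  obtain ⟨⟨y, m⟩, ⟨hyK, hyS, -⟩, hmin⟩ := hcomp.exists_isMinOn
    ⟨(y₀, r₀), h₀, ⟨hA₀, h₀⟩, hρ' _ _ h₀ hA₀, le_rfl⟩ continuous_snd.continuousOn
  refine ⟨y, m, hyK, hyS.1, fun y' r hy' hA' => ?_⟩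
  rcases le_total r r₀ with hr | hr
  · exact hmin (a := (y', r)) ⟨hy', ⟨hA', hup _ _ _ hy' hr⟩, hρ' _ _ hy' hA', hr⟩
  · exact (hmin (a := (y₀, r₀)) ⟨h₀, ⟨hA₀, h₀⟩, hρ' _ _ h₀ hA₀, le_rfl⟩).trans hr

/-- Lagrange multipliers for a convex set `K ⊆ E × ℝ` (an epigraph) under the linear constraint
`A y = 0`, when the feasible set is bounded. -/
theorem exists_multiplier_of_isBounded {K : Set (E × ℝ)} (hK : IsClosed K) (hKc : Convex ℝ K)
    (A : E →L[ℝ] F) (hb : Bornology.IsBounded {y | A y = 0 ∧ ∃ r, (y, r) ∈ K})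
    {y₀ : E} {m : ℝ} (h₀ : (y₀, m) ∈ K) (hA₀ : A y₀ = 0)
    (hmin : ∀ y r, (y, r) ∈ K → A y = 0 → m ≤ r) {β : ℝ} (hβ : β < m) :
    ∃ φ : F →L[ℝ] ℝ, ∀ y r, (y, r) ∈ K → β ≤ r + φ (A y) := by
  set B : E × ℝ →L[ℝ] F × ℝ := A.prodMap (ContinuousLinearMap.id ℝ ℝ)
  have hB : ∀ y r, B (y, r) = (A y, r) := fun y r => rfl
  have hnot : ((0 : F), β) ∉ closure (B '' K) := by
    intro hcl
    have hbd : Bornology.IsBounded (K ∩ B ⁻¹' segment ℝ (B (y₀, m)) ((0 : F), β)) := by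
      refine (hb.prod (Metric.isBounded_Icc β m)).subset ?_
      rintro ⟨y, r⟩ ⟨hyK, a, b, ha, hb', hab, hseg⟩
      rw [hB, hB, hA₀, Prod.ext_iff] at hseg
      have h1 : A y = 0 := by simpa using hseg.1.symm
      have h2 : a * m + b * β = r := by simpa using hseg.2
      obtain rfl : a = 1 - b := by linarith
      refine ⟨⟨h1, r, hyK⟩, ?_, ?_⟩
      · show β ≤ r
        nlinarith [mul_nonneg ha (sub_nonneg.2 hβ.le)]
      · show r ≤ m
        nlinarith [mul_nonneg hb' (sub_nonneg.2 hβ.le)]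
    obtain ⟨⟨y, r⟩, hyK, hy⟩ := mem_image_of_mem_closure_image_of_isBounded hK hKc B h₀ hbd hcl
    rw [hB, Prod.mk.injEq] at hy
    linarith [hmin y r hyK hy.1, hy.2]
  obtain ⟨ψ, u, hu, hψ⟩ := geometric_hahn_banach_point_closed
    (hKc.linear_image B.toLinearMap).closure isClosed_closure hnot
  have hsplit : ∀ z r, ψ (z, r) = ψ (z, 0) + r * ψ (0, 1) := by
    intro z r
    rw [← smul_eq_mul, ← map_smul, ← map_add]
    simp
  have hψK : ∀ y r, (y, r) ∈ K → u < ψ (A y, 0) + r * ψ (0, 1) := by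
    intro y r hy
    rw [← hsplit]
    exact hψ _ (subset_closure ⟨(y, r), hy, rfl⟩)
  rw [hsplit, show ((0 : F), (0 : ℝ)) = 0 from rfl, map_zero, zero_add] at hu
  have h1 := hψK _ _ h₀
  rw [hA₀, show ((0 : F), (0 : ℝ)) = 0 from rfl, map_zero, zero_add] at h1
  have hη : 0 < ψ (0, 1) := by
    by_contra! hη
    nlinarith
  refine ⟨(ψ (0, 1))⁻¹ • ψ.comp (ContinuousLinearMap.inl ℝ F ℝ), fun y r hy => ?_⟩
  have h2 := hψK _ _ hy
  have h3 : ((ψ (0, 1))⁻¹ • ψ.comp (ContinuousLinearMap.inl ℝ F ℝ)) (A y)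
      = (ψ (0, 1))⁻¹ * ψ (A y, 0) := by simp
  rw [h3]
  have h4 : ψ (0, 1) * (r + (ψ (0, 1))⁻¹ * ψ (A y, 0)) = r * ψ (0, 1) + ψ (A y, 0) := by
    field_simp
  refine le_of_mul_le_mul_left ?_ hη
  linarith

end ConvexGeometry

/-- If all sums of elements of nonempty sets of reals are bounded by `r`, then the sets have upper
bounds whose sum is at most `r`. -/
theorem exists_upperBounds_sum_le {ι : Type*} [Fintype ι] (S : ι → Set ℝ)
    (hne : ∀ i, (S i).Nonempty) {r : ℝ} (h : ∀ c : ι → ℝ, (∀ i, c i ∈ S i) → ∑ i, c i ≤ r) :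
    ∃ t : ι → ℝ, (∀ i, t i ∈ upperBounds (S i)) ∧ ∑ i, t i ≤ r := by
  choose b hb using hne
  have hbdd : ∀ i, BddAbove (S i) := by
    refine fun i => ⟨r - ∑ j ∈ Finset.univ.erase i, b j, fun c hc => ?_⟩
    have h1 := h (Function.update b i c) fun j => by
      by_cases hj : j = i
      · subst hj; simpa using hc
      · simpa [hj] using hb j
    rw [← Finset.add_sum_erase _ _ (Finset.mem_univ i), Function.update_self,
      Finset.sum_congr rfl fun j hj => Function.update_of_ne (Finset.ne_of_mem_erase hj) c b] at h1
    linarith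
  refine ⟨fun i => sSup (S i), fun i c hc => le_csSup (hbdd i) hc, ?_⟩
  refine le_of_forall_pos_le_add fun ε hε => ?_
  set δ := ε / (Fintype.card ι + 1)
  have hδ : 0 < δ := by positivity
  have hcard : Fintype.card ι * δ ≤ ε := by
    have : (Fintype.card ι + 1) * δ = ε := mul_div_cancel₀ _ (by positivity)
    linarith
  choose c hc hlt using fun i => exists_lt_of_lt_csSup ⟨b i, hb i⟩ (sub_lt_self (sSup (S i)) hδ)
  calc ∑ i, sSup (S i) ≤ ∑ i, (c i + δ) := Finset.sum_le_sum fun i _ => by linarith [hlt i]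
    _ = ∑ i, c i + Fintype.card ι * δ := by simp [Finset.sum_add_distrib]
    _ ≤ r + ε := add_le_add (h c hc) hcard

theorem nonneg_of_forall_le_add_mul {a b c : ℝ} (h : ∀ t : ℝ, 0 ≤ t → a ≤ b + c * t) : 0 ≤ c := by
  by_contra! hc
  have h1 := h ((|b - a| + 1) / -c) (div_nonneg (by positivity) (by linarith))
  have h2 : c * ((|b - a| + 1) / -c) = -(|b - a| + 1) := by
    rw [div_neg, mul_neg, mul_div_cancel₀ _ hc.ne]
  linarith [le_abs_self (b - a)]

theorem coe_sum_ereal {ι : Type*} (s : Finset ι) (g : ι → ℝ) :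
    ((∑ i ∈ s, g i : ℝ) : EReal) = ∑ i ∈ s, (g i : EReal) := by
  induction s using Finset.cons_induction with
  | empty => simp
  | cons i s hi ih => rw [Finset.sum_cons, Finset.sum_cons, EReal.coe_add, ih]

theorem dotp_add_left {n : ℕ} (x y z : Fin n → ℝ) : dotp (x + y) z = dotp x z + dotp y z :=
  add_dotProduct x y z

theorem dotp_smul_left {n : ℕ} (c : ℝ) (x y : Fin n → ℝ) : dotp (c • x) y = c * dotp x y :=
  smul_dotProduct c x y

theorem dotp_neg_left {n : ℕ} (x y : Fin n → ℝ) : dotp (-x) y = -dotp x y :=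
  neg_dotProduct x y

theorem dotp_zero_left {n : ℕ} (x : Fin n → ℝ) : dotp 0 x = 0 :=
  zero_dotProduct x

theorem dotp_comm {n : ℕ} (x y : Fin n → ℝ) : dotp x y = dotp y x :=
  dotProduct_comm x y

theorem dotp_sub_right {n : ℕ} (x y z : Fin n → ℝ) : dotp x (y - z) = dotp x y - dotp x z :=
  dotProduct_sub x y z

theorem dotp_sum_left {n : ℕ} {ι : Type*} (s : Finset ι) (u : ι → Fin n → ℝ) (x : Fin n → ℝ) :
    dotp (∑ i ∈ s, u i) x = ∑ i ∈ s, dotp (u i) x :=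
  sum_dotProduct s u x

theorem exists_forall_eq_dotp {n : ℕ} (φ : (Fin n → ℝ) →ₗ[ℝ] ℝ) : ∃ w, ∀ x, φ x = dotp w x := by
  refine ⟨fun j => φ (Pi.single j 1), fun x => ?_⟩
  rw [LinearMap.pi_apply_eq_sum_univ φ x]
  refine Finset.sum_congr rfl fun j _ => ?_
  rw [smul_eq_mul, mul_comm]
  congr 2
  ext k
  simp [Pi.single_apply, eq_comm]

theorem exists_forall_eq_sum_dotp_add_sum_mul {n I : ℕ}
    (φ : (Fin I → Fin n → ℝ) × (Fin I → ℝ) →ₗ[ℝ] ℝ) :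
    ∃ (ξ : Fin I → Fin n → ℝ) (μ : Fin I → ℝ),
      ∀ u s, φ (u, s) = ∑ i, dotp (ξ i) (u i) + ∑ i, μ i * s i := by
  choose ξ hξ using fun i : Fin I => exists_forall_eq_dotp
    ((φ ∘ₗ LinearMap.inl ℝ _ _) ∘ₗ LinearMap.single ℝ (fun _ : Fin I => Fin n → ℝ) i)
  obtain ⟨μ, hμ⟩ := exists_forall_eq_dotp (φ ∘ₗ LinearMap.inr ℝ (Fin I → Fin n → ℝ) _)
  refine ⟨ξ, μ, fun u s => ?_⟩
  have h1 : φ (u, s) = (φ ∘ₗ LinearMap.inl ℝ _ _) u + (φ ∘ₗ LinearMap.inr ℝ _ _) s := by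
    simp [← map_add]
  rw [h1, hμ, ← Finset.univ_sum_single u, map_sum]
  simp only [Finset.univ_sum_single, ← hξ]
  rfl

section Epigraph

variable {n : ℕ} {f : (Fin n → ℝ) → EReal}

theorem ClosedFn.isClosed_epigraph (hf : ClosedFn f) :
    IsClosed {p : (Fin n → ℝ) × ℝ | f p.1 ≤ (p.2 : EReal)} :=
  hf.1.isClosed_epigraph.preimage
    (continuous_fst.prodMk (continuous_coe_real_ereal.comp continuous_snd))

theorem ProperFn.exists_le_coe (hf : ProperFn f) : ∃ x, ∃ s : ℝ, f x ≤ s := by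
  obtain ⟨x, hx⟩ := hf.2
  obtain ⟨s, hs, -⟩ := EReal.lt_iff_exists_real_btwn.1 (lt_top_iff_ne_top.2 hx)
  exact ⟨x, s, hs.le⟩

theorem exists_not_le_coe {a : EReal} (ha : a ≠ ⊥) : ∃ r : ℝ, ¬ a ≤ r := by
  obtain ⟨r, -, hr⟩ := EReal.lt_iff_exists_real_btwn.1 (bot_lt_iff_ne_bot.2 ha)
  exact ⟨r, not_le.2 hr⟩

/-- Strict separation of a point from the epigraph of a closed convex function. -/
theorem exists_separation_epigraph (hp : ProperFn f) (hc : ClosedFn f) (hv : ConvexFn f)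
    {x : Fin n → ℝ} {a : ℝ} (hx : ¬ f x ≤ a) :
    ∃ (w : Fin n → ℝ) (t c : ℝ), 0 ≤ t ∧ (∀ y (s : ℝ), f y ≤ s → dotp w y - t * s ≤ c) ∧
      c < dotp w x - t * a := by
  obtain ⟨ψ, u, hu, hψ⟩ := geometric_hahn_banach_point_closed hv hc.isClosed_epigraph
    (show (x, a) ∉ {p : (Fin n → ℝ) × ℝ | f p.1 ≤ (p.2 : EReal)} from hx)
  obtain ⟨w, hw⟩ := exists_forall_eq_dotp (ψ.toLinearMap ∘ₗ LinearMap.inl ℝ _ _)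
  have hsplit : ∀ y s, ψ (y, s) = dotp w y + s * ψ (0, 1) := by
    intro y s
    rw [← hw, ← smul_eq_mul, ← map_smul]
    simp [← map_add]
  rw [hsplit] at hu
  have hsep : ∀ y (s : ℝ), f y ≤ s → u < dotp w y + s * ψ (0, 1) := fun y s hy => by
    rw [← hsplit]
    exact hψ (y, s) hy
  refine ⟨-w, ψ (0, 1), -u, ?_, fun y s hy => ?_, ?_⟩
  · obtain ⟨y, s, hy⟩ := hp.exists_le_coe
    refine nonneg_of_forall_le_add_mul (a := u) (b := dotp w y + s * ψ (0, 1)) fun t ht => ?_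
    have := hsep y (s + t) (hy.trans (by exact_mod_cast le_add_of_nonneg_right ht))
    linarith
  · rw [dotp_neg_left]
    linarith [hsep y s hy]
  · rw [dotp_neg_left]
    linarith

theorem exists_affine_minorant (hp : ProperFn f) (hc : ClosedFn f) (hv : ConvexFn f) :
    ∃ (w : Fin n → ℝ) (c : ℝ), ∀ y (s : ℝ), f y ≤ s → dotp w y - s ≤ c := by
  obtain ⟨x, s, hx⟩ := hp.exists_le_coe
  obtain ⟨a, ha⟩ := exists_not_le_coe (hp.1 x)
  obtain ⟨w, t, c, -, hsep, hlt⟩ := exists_separation_epigraph hp hc hv ha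
  have has : a < s := by exact_mod_cast (not_le.1 ha).trans_le hx
  have ht : 0 < t := by
    by_contra! ht
    nlinarith [hsep x s hx]
  refine ⟨t⁻¹ • w, t⁻¹ * c, fun y s hy => ?_⟩
  have h1 : t⁻¹ * (dotp w y - t * s) = dotp (t⁻¹ • w) y - s := by
    rw [dotp_smul_left]
    field_simp
  rw [← h1]
  exact mul_le_mul_of_nonneg_left (hsep y s hy) (inv_nonneg.2 ht.le)

theorem conjFn_le_coe_iff {w : Fin n → ℝ} {a : ℝ} :
    conjFn f w ≤ a ↔ ∀ x (s : ℝ), f x ≤ s → dotp w x - s ≤ a := by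
  rw [conjFn, iSup_le_iff]
  refine forall_congr' fun x => ⟨fun h s hs => ?_, fun h => ?_⟩
  · have := (EReal.sub_le_sub le_rfl hs).trans h
    exact_mod_cast this
  · induction hfx : f x with
    | bot =>
      have := h (dotp w x - a - 1) (by rw [hfx]; exact bot_le)
      linarith
    | top => simp
    | coe s => exact_mod_cast h s hfx.le

theorem suppFn_edom_conjFn_conjFn_le_coe_iff (hp : ProperFn f) (hc : ClosedFn f)
    (hv : ConvexFn f) {w : Fin n → ℝ} {a : ℝ} :
    suppFn (edom (conjFn (conjFn f))) w ≤ a ↔ ∀ x (s : ℝ), f x ≤ s → dotp w x ≤ a := by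
  simp only [suppFn, iSup_le_iff, EReal.coe_le_coe_iff]
  refine ⟨fun h x s hx => ?_, fun h z hz => ?_⟩
  · rw [dotp_comm]
    refine h x (lt_of_le_of_lt (conjFn_le_coe_iff.2 fun v r hv => ?_) (EReal.coe_lt_top s))
    rw [dotp_comm]
    linarith [conjFn_le_coe_iff.1 hv x s hx]
  · obtain ⟨M, hM, -⟩ := EReal.lt_iff_exists_real_btwn.1 (show conjFn (conjFn f) z < ⊤ from hz)
    obtain ⟨v, c, hvc⟩ := exists_affine_minorant hp hc hv
    refine sub_nonneg.1 (nonneg_of_forall_le_add_mul (a := dotp z v - c) (b := M) fun t ht => ?_)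
    have h1 : conjFn f (v + t • w) ≤ ((c + t * a : ℝ) : EReal) :=
      conjFn_le_coe_iff.2 fun x s hx => by
        rw [dotp_add_left, dotp_smul_left]
        nlinarith [hvc x s hx, mul_le_mul_of_nonneg_left (h x s hx) ht]
    have h2 := conjFn_le_coe_iff.1 hM.le _ _ h1
    rw [dotp_comm, dotp_add_left, dotp_smul_left, dotp_comm v, dotp_comm w] at h2
    linarith

theorem persp_conjFn_le_coe_iff (hp : ProperFn f) (hc : ClosedFn f) (hv : ConvexFn f)
    {w : Fin n → ℝ} {t a : ℝ} (ht : 0 ≤ t) :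
    persp (conjFn f) w t ≤ a ↔ ∀ x (s : ℝ), f x ≤ s → dotp w x - t * s ≤ a := by
  rcases ht.eq_or_lt with rfl | ht
  · simp only [persp, lt_irrefl, if_false, zero_mul, sub_zero]
    exact suppFn_edom_conjFn_conjFn_le_coe_iff hp hc hv
  · rw [persp, if_pos ht, mul_comm,
      ← EReal.le_div_iff_mul_le (by exact_mod_cast ht) (EReal.coe_ne_top t), ← EReal.coe_div,
      conjFn_le_coe_iff]
    refine forall₃_congr fun x s _ => ?_
    rw [le_div_iff₀ ht, dotp_smul_left]
    have : (t⁻¹ * dotp w x - s) * t = dotp w x - t * s := by field_simp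
    rw [this]

end Epigraph

theorem coe_neg_le_dualObj_iff {n I : ℕ} {f : Fin (I + 1) → (Fin n → ℝ) → EReal}
    (hF : AssumptionF f) {w : Fin (I + 1) → Fin n → ℝ} {lam : Fin I → ℝ} (hlam : ∀ i, 0 ≤ lam i)
    {r : ℝ} :
    ((-r : ℝ) : EReal) ≤ dualObj f w lam ↔
      ∀ (x : Fin (I + 1) → Fin n → ℝ) (s : Fin (I + 1) → ℝ), (∀ i, f i (x i) ≤ s i) →
        ∑ i, dotp (w i) (x i) - s 0 - ∑ i, lam i * s i.succ ≤ r := by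
  constructor
  · intro h x s hxs
    have h0 : ((dotp (w 0) (x 0) - s 0 : ℝ) : EReal) ≤ conjFn (f 0) (w 0) :=
      EReal.le_of_forall_lt_iff_le.1 fun z hz => by
        exact_mod_cast conjFn_le_coe_iff.1 hz.le _ _ (hxs 0)
    have hi : ∀ i : Fin I, ((dotp (w i.succ) (x i.succ) - lam i * s i.succ : ℝ) : EReal) ≤
        persp (conjFn (f i.succ)) (w i.succ) (lam i) := fun i =>
      EReal.le_of_forall_lt_iff_le.1 fun z hz => by
        obtain ⟨hp, hc, hv⟩ := hF i.succ
        exact_mod_cast (persp_conjFn_le_coe_iff hp hc hv (hlam i)).1 hz.le _ _ (hxs i.succ)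
    have h1 := h.trans (EReal.sub_le_sub (EReal.neg_le_neg_iff.2 h0)
      (Finset.sum_le_sum fun i (_ : i ∈ Finset.univ) => hi i))
    rw [← coe_sum_ereal] at h1
    norm_cast at h1
    rw [Finset.sum_sub_distrib] at h1
    rw [Fin.sum_univ_succ]
    linarith
  · intro h
    set ℓ : Fin (I + 1) → ℝ := Fin.cons 1 lam
    obtain ⟨t, ht, htr⟩ := exists_upperBounds_sum_le (r := r)
      (fun i => {c | ∃ y, ∃ s : ℝ, f i y ≤ s ∧ c = dotp (w i) y - ℓ i * s})
      (fun i => by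
        obtain ⟨y, s, hy⟩ := (hF i).1.exists_le_coe
        exact ⟨_, y, s, hy, rfl⟩)
      (fun c hc => by
        choose y s hy hcy using hc
        have h1 := h y s hy
        simp only [hcy, Finset.sum_sub_distrib]
        rw [Fin.sum_univ_succ (fun i => ℓ i * s i)]
        simp only [ℓ, Fin.cons_zero, Fin.cons_succ]
        linarith)
    have h0 : conjFn (f 0) (w 0) ≤ (t 0 : EReal) :=
      conjFn_le_coe_iff.2 fun y s hy => ht 0 ⟨y, s, hy, by simp [ℓ]⟩
    have hi : ∀ i : Fin I, persp (conjFn (f i.succ)) (w i.succ) (lam i) ≤ (t i.succ : EReal) :=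
      fun i => by
        obtain ⟨hp, hc, hv⟩ := hF i.succ
        exact (persp_conjFn_le_coe_iff hp hc hv (hlam i)).2 fun y s hy =>
          ht i.succ ⟨y, s, hy, by simp [ℓ]⟩
    refine le_trans ?_ (EReal.sub_le_sub (EReal.neg_le_neg_iff.2 h0)
      (Finset.sum_le_sum fun i (_ : i ∈ Finset.univ) => hi i))
    rw [← coe_sum_ereal]
    norm_cast
    rw [Fin.sum_univ_succ] at htr
    linarith

theorem dualVal_le_primalVal {n I : ℕ} {f : Fin (I + 1) → (Fin n → ℝ) → EReal}
    (hF : AssumptionF f) : dualVal f ≤ primalVal f := by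
  refine iSup₂_le fun p hp => le_iInf₂ fun x hx => ?_
  refine EReal.ge_of_forall_gt_iff_ge.1 fun z hz => ?_
  refine EReal.le_of_forall_lt_iff_le.1 fun a ha => ?_
  have h := (coe_neg_le_dualObj_iff hF hp.2.1 (r := -z)).1 (by simpa using hz.le)
    (fun _ => x) (Fin.cons a fun _ => 0) (fun i => by
      refine Fin.cases ?_ (fun i => ?_) i
      · simpa using ha.le
      · simpa using hx.1 i)
  rw [← dotp_sum_left, hp.1, dotp_zero_left] at h
  simp only [Fin.cons_zero, Fin.cons_succ, mul_zero, Finset.sum_const_zero] at h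
  exact_mod_cast (by linarith : z ≤ a)

theorem primalVal_eq_dualVal_of_isBounded_primalFeas {n I : ℕ}
    {f : Fin (I + 1) → (Fin n → ℝ) → EReal} (hF : AssumptionF f) (hne : (primalFeas f).Nonempty)
    (hb : Bornology.IsBounded (primalFeas f)) :
    primalVal f = dualVal f ∧ primalSolvable f := by
  set K : Set (((Fin (I + 1) → Fin n → ℝ) × (Fin I → ℝ)) × ℝ) :=
    {q | f 0 (q.1.1 0) ≤ q.2 ∧ ∀ i : Fin I, f i.succ (q.1.1 i.succ) ≤ q.1.2 i}
  have hK : IsClosed K := by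
    refine ((hF 0).2.1.isClosed_epigraph.preimage (by fun_prop :
      Continuous fun q : ((Fin (I + 1) → Fin n → ℝ) × (Fin I → ℝ)) × ℝ => (q.1.1 0, q.2))).inter ?_
    change IsClosed {q : ((Fin (I + 1) → Fin n → ℝ) × (Fin I → ℝ)) × ℝ |
      ∀ i : Fin I, f i.succ (q.1.1 i.succ) ≤ q.1.2 i}
    rw [Set.ofPred_forall]
    exact isClosed_iInter fun i => (hF i.succ).2.1.isClosed_epigraph.preimage (by fun_prop :
      Continuous fun q : ((Fin (I + 1) → Fin n → ℝ) × (Fin I → ℝ)) × ℝ => (q.1.1 i.succ, q.1.2 i))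
  have hKc : Convex ℝ K := fun p hp q hq a b ha hb hab =>
    ⟨(hF 0).2.2 (x := (p.1.1 0, p.2)) hp.1 (y := (q.1.1 0, q.2)) hq.1 ha hb hab,
      fun i => (hF i.succ).2.2 (x := (p.1.1 i.succ, p.1.2 i)) (hp.2 i)
        (y := (q.1.1 i.succ, q.1.2 i)) (hq.2 i) ha hb hab⟩
  set A : (Fin (I + 1) → Fin n → ℝ) × (Fin I → ℝ) →L[ℝ] (Fin I → Fin n → ℝ) × (Fin I → ℝ) :=
    ((ContinuousLinearMap.pi fun i : Fin I =>
      (ContinuousLinearMap.proj (R := ℝ) (φ := fun _ : Fin (I + 1) => Fin n → ℝ) i.succ -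
        ContinuousLinearMap.proj (R := ℝ) (φ := fun _ : Fin (I + 1) => Fin n → ℝ) 0)).comp
      (ContinuousLinearMap.fst ℝ _ _)).prod (ContinuousLinearMap.snd ℝ _ _)
  have hA : ∀ x s, A (x, s) = (fun i => x i.succ - x 0, s) := fun x s => rfl
  have hA0 : ∀ y, A y = 0 → y = (fun _ => y.1 0, 0) := by
    rintro ⟨x, s⟩ h
    rw [hA, Prod.mk_eq_zero] at h
    refine Prod.ext (funext fun i => ?_) h.2
    refine Fin.cases rfl (fun i => ?_) i
    exact sub_eq_zero.1 (congrFun h.1 i)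
  have hAc : ∀ x : Fin n → ℝ, A (fun _ => x, 0) = 0 := fun x => by
    rw [hA]
    simp only [sub_self]
    rfl
  have hfeas : ∀ (x : Fin n → ℝ) (r : ℝ), ((fun _ => x, 0), r) ∈ K → x ∈ primalFeas f :=
    fun x r hx => ⟨fun i => by simpa using hx.2 i, ne_top_of_le_ne_top (EReal.coe_ne_top r) hx.1⟩
  have hmemK : ∀ x ∈ primalFeas f, ∀ r : ℝ, f 0 x ≤ r → ((fun _ => x, 0), r) ∈ K :=
    fun x hx r hr => ⟨hr, fun i => by simpa using hx.1 i⟩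
  have hbd : Bornology.IsBounded {y | A y = 0 ∧ ∃ r, (y, r) ∈ K} := by
    obtain ⟨R, hR⟩ := hb.subset_closedBall 0
    refine (Metric.isBounded_closedBall (x := 0) (r := max R 0)).subset ?_
    rintro y ⟨hy, r, hr⟩
    rw [hA0 y hy] at hr ⊢
    have h1 : ‖y.1 0‖ ≤ R := by simpa using hR (hfeas _ _ hr)
    rw [mem_closedBall_zero_iff, Prod.norm_mk, norm_zero]
    refine max_le ?_ (le_max_right _ _)
    exact (pi_norm_le_iff_of_nonneg (le_max_right _ _)).2 fun _ => h1.trans (le_max_left _ _)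
  obtain ⟨x₀, hx₀⟩ := hne
  obtain ⟨r₀, hr₀, -⟩ := EReal.lt_iff_exists_real_btwn.1 (lt_top_iff_ne_top.2 hx₀.2)
  obtain ⟨y, m, hyK, hAy, hmin⟩ := exists_lowest_point hK
    (fun y r r' h hr => ⟨h.1.trans (by exact_mod_cast hr), h.2⟩)
    (fun y => by
      obtain ⟨r, hr⟩ := exists_not_le_coe ((hF 0).1.1 (y.1 0))
      exact ⟨r, fun h => hr h.1⟩)
    A ⟨_, r₀, hmemK x₀ hx₀ r₀ hr₀.le, hAc x₀⟩ hbd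
  have hx : y.1 0 ∈ primalFeas f := hfeas _ m (hA0 y hAy ▸ hyK)
  have hm : (m : EReal) ≤ primalVal f := le_iInf₂ fun x hx =>
    EReal.le_of_forall_lt_iff_le.1 fun r hr => by
      exact_mod_cast hmin _ r (hmemK x hx r hr.le) (hAc x)
  refine ⟨le_antisymm ?_ (dualVal_le_primalVal hF),
    Or.inr ⟨_, hx, le_antisymm (hyK.1.trans hm) (iInf₂_le _ hx)⟩⟩
  refine ((iInf₂_le _ hx).trans hyK.1).trans (EReal.ge_of_forall_gt_iff_ge.1 fun β hβ => ?_)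
  obtain ⟨φ, hφ⟩ := exists_multiplier_of_isBounded hK hKc A hbd hyK hAy hmin
    (by exact_mod_cast hβ : β < m)
  obtain ⟨ξ, μ, hξμ⟩ := exists_forall_eq_sum_dotp_add_sum_mul φ.toLinearMap
  have hmul : ∀ (x : Fin (I + 1) → Fin n → ℝ) (s : Fin (I + 1) → ℝ), (∀ i, f i (x i) ≤ s i) →
      β ≤ s 0 + (∑ i, dotp (ξ i) (x i.succ - x 0) + ∑ i, μ i * s i.succ) := by
    intro x s hxs
    rw [← hξμ (fun i => x i.succ - x 0) (fun i => s i.succ)]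
    exact hφ (x, fun i => s i.succ) (s 0) ⟨hxs 0, fun i => hxs i.succ⟩
  have hμ : ∀ i, 0 ≤ μ i := by
    intro i
    choose x s hxs using fun j => (hF j).1.exists_le_coe
    refine nonneg_of_forall_le_add_mul (a := β)
      (b := s 0 + (∑ j, dotp (ξ j) (x j.succ - x 0) + ∑ j, μ j * s j.succ)) fun t ht => ?_
    have h1 := hmul x (s + Pi.single i.succ t) fun j => (hxs j).trans <| by
      have : 0 ≤ (Pi.single i.succ t : Fin (I + 1) → ℝ) j :=
        (Pi.single_nonneg.2 ht : (0 : Fin (I + 1) → ℝ) ≤ Pi.single i.succ t) j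
      exact_mod_cast le_add_of_nonneg_right this
    simp only [Pi.add_apply, mul_add, Finset.sum_add_distrib, Pi.single_apply, Fin.succ_inj,
      mul_ite, mul_zero, Finset.sum_ite_eq', Finset.mem_univ, if_true,
      (Fin.succ_ne_zero i).symm, if_false] at h1
    linarith
  set w : Fin (I + 1) → Fin n → ℝ := Fin.cons (∑ i, ξ i) fun i => -ξ i
  have hobj : (β : EReal) ≤ dualObj f w μ := by
    have := (coe_neg_le_dualObj_iff hF hμ (w := w) (r := -β)).2 fun x s hxs => by
      have h1 := hmul x s hxs
      simp only [dotp_sub_right, Finset.sum_sub_distrib] at h1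
      rw [Fin.sum_univ_succ]
      simp only [w, Fin.cons_zero, Fin.cons_succ, dotp_sum_left, dotp_neg_left,
        Finset.sum_neg_distrib]
      linarith
    simpa using this
  have hw : ∑ i, w i = 0 := by
    rw [Fin.sum_univ_succ]
    simp [w]
  exact hobj.trans (le_iSup₂ (f := fun p (_ : p ∈ dualFeas f) => dualObj f p.1 p.2) (w, μ)
    ⟨hw, hμ, ne_bot_of_le_ne_bot (EReal.coe_ne_bot β) hobj⟩)

theorem primalVal_eq_dualVal_of_isBounded_dualFeas {n I : ℕ}
    {f : Fin (I + 1) → (Fin n → ℝ) → EReal} (hF : AssumptionF f) (hne : (dualFeas f).Nonempty)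
    (hb : Bornology.IsBounded (dualFeas f)) :
    primalVal f = dualVal f ∧ dualSolvable f := by
  set K : Set (((Fin (I + 1) → Fin n → ℝ) × (Fin I → ℝ)) × ℝ) :=
    {q | (∀ i, 0 ≤ q.1.2 i) ∧ ∀ (x : Fin (I + 1) → Fin n → ℝ) (s : Fin (I + 1) → ℝ),
      (∀ i, f i (x i) ≤ s i) →
        ∑ i, dotp (q.1.1 i) (x i) - s 0 - ∑ i, q.1.2 i * s i.succ ≤ q.2}
  have hK : IsClosed K := by
    simp only [K, dotp, Set.ofPred_and, Set.ofPred_forall]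
    refine (isClosed_iInter fun i => isClosed_le (by fun_prop) (by fun_prop)).inter ?_
    exact isClosed_iInter fun x => isClosed_iInter fun s => isClosed_iInter fun _ =>
      isClosed_le (by fun_prop) (by fun_prop)
  have hKc : Convex ℝ K := by
    rintro p hp q hq a b ha hb hab
    refine ⟨fun i => add_nonneg (mul_nonneg ha (hp.1 i)) (mul_nonneg hb (hq.1 i)),
      fun x s hxs => ?_⟩
    have h1 := mul_le_mul_of_nonneg_left (hp.2 x s hxs) ha
    have h2 := mul_le_mul_of_nonneg_left (hq.2 x s hxs) hb
    obtain rfl : b = 1 - a := by linarith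
    simp only [Prod.fst_add, Prod.snd_add, Prod.smul_fst, Prod.smul_snd, Pi.add_apply,
      Pi.smul_apply, dotp_add_left, dotp_smul_left, Finset.sum_add_distrib, ← Finset.mul_sum,
      smul_eq_mul, add_mul, mul_assoc]
    linarith
  set A : (Fin (I + 1) → Fin n → ℝ) × (Fin I → ℝ) →L[ℝ] Fin n → ℝ :=
    (∑ i, ContinuousLinearMap.proj i : (Fin (I + 1) → Fin n → ℝ) →L[ℝ] Fin n → ℝ).comp
      (ContinuousLinearMap.fst ℝ _ _)
  have hA : ∀ p, A p = ∑ i, p.1 i := fun p => by simp [A]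
  have hKobj : ∀ p r, (p, r) ∈ K → ((-r : ℝ) : EReal) ≤ dualObj f p.1 p.2 := fun p r h =>
    (coe_neg_le_dualObj_iff hF h.1).2 h.2
  have hmemK : ∀ p ∈ dualFeas f, ∀ r : ℝ, ((-r : ℝ) : EReal) ≤ dualObj f p.1 p.2 → (p, r) ∈ K :=
    fun p hp r hr => ⟨hp.2.1, (coe_neg_le_dualObj_iff hF hp.2.1).1 hr⟩
  have hfeas : ∀ p r, (p, r) ∈ K → A p = 0 → p ∈ dualFeas f := fun p r h hp =>
    ⟨hA p ▸ hp, h.1, ne_bot_of_le_ne_bot (EReal.coe_ne_bot _) (hKobj p r h)⟩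
  have hbd : Bornology.IsBounded {y | A y = 0 ∧ ∃ r, (y, r) ∈ K} :=
    hb.subset fun y ⟨hy, r, hr⟩ => hfeas y r hr hy
  obtain ⟨p₀, hp₀⟩ := hne
  obtain ⟨r₀, -, hr₀⟩ := EReal.lt_iff_exists_real_btwn.1 (bot_lt_iff_ne_bot.2 hp₀.2.2)
  obtain ⟨p, m, hpK, hAp, hmin⟩ := exists_lowest_point hK
    (fun y r r' h hr => ⟨h.1, fun x s hxs => (h.2 x s hxs).trans hr⟩)
    (fun y => by
      choose x s hxs using fun j => (hF j).1.exists_le_coe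
      refine ⟨∑ i, dotp (y.1 i) (x i) - s 0 - ∑ i, y.2 i * s i.succ - 1, fun h => ?_⟩
      linarith [h.2 x s hxs])
    A ⟨p₀, -r₀, hmemK p₀ hp₀ _ (by simpa using hr₀.le), (hA p₀).trans hp₀.1⟩ hbd
  have hp : p ∈ dualFeas f := hfeas p m hpK hAp
  have hm : dualVal f ≤ ((-m : ℝ) : EReal) := iSup₂_le fun q hq =>
    EReal.ge_of_forall_gt_iff_ge.1 fun z hz => by
      have := hmin q (-z) (hmemK q hq _ (by simpa using hz.le)) ((hA q).trans hq.1)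
      exact_mod_cast (by linarith : z ≤ -m)
  have hple : dualObj f p.1 p.2 ≤ dualVal f :=
    le_iSup₂ (f := fun p (_ : p ∈ dualFeas f) => dualObj f p.1 p.2) p hp
  refine ⟨le_antisymm ?_ (dualVal_le_primalVal hF),
    Or.inr ⟨p, hp, le_antisymm hple (hm.trans (hKobj p m hpK))⟩⟩
  refine le_trans (EReal.le_of_forall_lt_iff_le.1 fun γ hγ => ?_) ((hKobj p m hpK).trans hple)
  obtain ⟨β, rfl⟩ : ∃ β, γ = -β := ⟨-γ, (neg_neg γ).symm⟩
  have hβ : β < m := by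
    have : -m < -β := by exact_mod_cast hγ
    linarith
  obtain ⟨φ, hφ⟩ := exists_multiplier_of_isBounded hK hKc A hbd hpK hAp hmin hβ
  obtain ⟨v, hv⟩ := exists_forall_eq_dotp φ.toLinearMap
  set x := -v
  have hx : ∀ q r, (q, r) ∈ K → dotp (∑ i, q.1 i) x ≤ r - β := by
    intro q r hq
    have h1 := hφ q r hq
    have h2 : φ (A q) = -dotp (∑ i, q.1 i) x := by
      rw [dotp_comm, dotp_neg_left, neg_neg, ← hA]
      exact hv _
    linarith
  obtain ⟨w₀, c₀, hw₀⟩ := exists_affine_minorant (hF 0).1 (hF 0).2.1 (hF 0).2.2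
  have hobj : f 0 x ≤ ((-β : ℝ) : EReal) := by
    by_contra hcon
    obtain ⟨w, l, c, hl, hsep, hlt⟩ :=
      exists_separation_epigraph (hF 0).1 (hF 0).2.1 (hF 0).2.2 hcon
    refine absurd (nonneg_of_forall_le_add_mul (a := dotp w₀ x) (b := c₀ - β)
      (c := c - (dotp w x - l * -β)) fun t ht => ?_) (by linarith)
    have hpos : 0 < 1 + t * l := by positivity
    have h1 := hx ((Fin.cons ((1 + t * l)⁻¹ • (w₀ + t • w)) 0, 0)) ((1 + t * l)⁻¹ * (c₀ + t * c))
      ⟨fun i => le_rfl, fun y s hys => by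
        have h2 : ((1 + t * l) : ℝ)⁻¹ * (dotp w₀ (y 0) - s 0 + t * (dotp w (y 0) - l * s 0)) ≤
            (1 + t * l)⁻¹ * (c₀ + t * c) :=
          mul_le_mul_of_nonneg_left (add_le_add (hw₀ _ _ (hys 0))
            (mul_le_mul_of_nonneg_left (hsep _ _ (hys 0)) ht)) (inv_nonneg.2 hpos.le)
        have h3 : (1 + t * l)⁻¹ * (dotp w₀ (y 0) - s 0 + t * (dotp w (y 0) - l * s 0)) =
            (1 + t * l)⁻¹ * (dotp w₀ (y 0) + t * dotp w (y 0)) - s 0 := by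
          field_simp
          ring
        rw [Fin.sum_univ_succ]
        simp only [Fin.cons_zero, Fin.cons_succ, Pi.zero_apply, dotp_zero_left,
          Finset.sum_const_zero, zero_mul, dotp_add_left, dotp_smul_left]
        linarith⟩
    rw [Fin.sum_univ_succ] at h1
    simp only [Fin.cons_zero, Fin.cons_succ, Pi.zero_apply, Finset.sum_const_zero, add_zero,
      dotp_add_left, dotp_smul_left] at h1
    have h4 := mul_le_mul_of_nonneg_left h1 hpos.le
    rw [mul_sub, mul_inv_cancel_left₀ hpos.ne', mul_inv_cancel_left₀ hpos.ne'] at h4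
    linarith
  have hcons : ∀ i : Fin I, f i.succ x ≤ 0 := by
    intro i
    by_contra hcon
    obtain ⟨w, l, c, hl, hsep, hlt⟩ := exists_separation_epigraph (a := 0) (hF i.succ).1
      (hF i.succ).2.1 (hF i.succ).2.2 (by simpa using hcon)
    refine absurd (nonneg_of_forall_le_add_mul (a := dotp w₀ x) (b := c₀ - β)
      (c := c - (dotp w x - l * 0)) fun t ht => ?_) (by linarith)
    have h1 := hx (Fin.cons w₀ (Pi.single i (t • w)), Pi.single i (t * l)) (c₀ + t * c)
      ⟨(Pi.single_nonneg.2 (mul_nonneg ht hl) : (0 : Fin I → ℝ) ≤ Pi.single i (t * l)),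
      fun y s hys => by
        have h2 := mul_le_mul_of_nonneg_left (hsep _ _ (hys i.succ)) ht
        have h3 : ∑ j, dotp ((Pi.single i (t • w) : Fin I → Fin n → ℝ) j) (y j.succ) =
            t * dotp w (y i.succ) := by
          rw [Finset.sum_eq_single i (fun j _ hj => by
            rw [Pi.single_eq_of_ne hj, dotp_zero_left]) (by simp), Pi.single_eq_same,
            dotp_smul_left]
        have h4 : ∑ j, (Pi.single i (t * l) : Fin I → ℝ) j * s j.succ = t * l * s i.succ := by
          simp [Pi.single_apply]
        rw [Fin.sum_univ_succ]
        simp only [Fin.cons_zero, Fin.cons_succ, h3, h4]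
        linarith [hw₀ _ _ (hys 0)]⟩
    rw [Fin.sum_univ_succ] at h1
    simp only [Fin.cons_zero, Fin.cons_succ, Finset.sum_pi_single',
      Finset.mem_univ, if_true, dotp_add_left, dotp_smul_left] at h1
    linarith
  exact (iInf₂_le x ⟨hcons, ne_top_of_le_ne_top (EReal.coe_ne_top _) hobj⟩).trans hobj

/-- **Strong duality for convex programs under a boundedness condition**
(Theorem 2.2 (ii)): under assumption (F), if the feasible region of (P) is nonempty and
bounded then `inf (P) = sup (D)` and (P) is solvable; if the feasible region of (D) is
nonempty and bounded then `inf (P) = sup (D)` and (D) is solvable. -/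
theorem strong_duality_bounded (n I : ℕ) (f : Fin (I + 1) → (Fin n → ℝ) → EReal)
    (hF : AssumptionF f) :
    ((primalFeas f).Nonempty → Bornology.IsBounded (primalFeas f) →
      primalVal f = dualVal f ∧ primalSolvable f) ∧
    ((dualFeas f).Nonempty → Bornology.IsBounded (dualFeas f) →
      primalVal f = dualVal f ∧ dualSolvable f) := by
  exact ⟨primalVal_eq_dualVal_of_isBounded_primalFeas hF,
    primalVal_eq_dualVal_of_isBounded_dualFeas hF⟩
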